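/- (Corollary 2, sufficient condition for the general safe set) Let ε ∈ (0,1), α ∈ [0,1], f : ℝ^n → ℝ^n, g : ℝ^n → ℝ^{n×m}, and let Σ_w ∈ ℝ^{n×n} be symmetric positive definite. Let h : ℝ^n → ℝ be twice continuously differentiable with −σ I ⪯ ∇²h(y) for all y ∈ ℝ^n for some σ ≥ 0. Fix x ∈ ℝ^n and u ∈ ℝ^m, define w̄ ∈ ℝ^n by w̄_i = WCVaR_ε[w ↦ w_i] (over 𝒫(Σ_w)), assumed finite for each i, and set x̄⁺ = f(x) + g(x)u + w̄. If −h(x̄⁺) + WCVaR_ε[w ↦ −∇h(x̄⁺)ᵀ(w − w̄) + (σ/2)·‖w − w̄‖²] ≤ −α h(x), then the risk-aware CBF constraint WCVaR_ε[w ↦ −h(f(x)+g(x)u+w)] ≤ −α h(x) holds. -/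

import Mathlib

open MeasureTheory RealInnerProductSpace

/-- Conditional value-at-risk of a loss at level ε with respect to P. -/
noncomputable def CVaR {n : ℕ} (ε : ℝ) (P : Measure (EuclideanSpace ℝ (Fin n)))
    (L : EuclideanSpace ℝ (Fin n) → ℝ) : ℝ :=
  ⨅ β : ℝ, (β + (1 / ε) * ∫ w, max (L w - β) 0 ∂P)

/-- The set of Borel probability measures on ℝ^n with finite second moments,
zero mean, and second-moment matrix Σ. -/
def Pset (n : ℕ) (S : Matrix (Fin n) (Fin n) ℝ) :
    Set (Measure (EuclideanSpace ℝ (Fin n))) :=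
  {P | IsProbabilityMeasure P ∧ Integrable (fun w => ‖w‖ ^ 2) P ∧
    (∀ i, ∫ w, w i ∂P = 0) ∧ ∀ i j, ∫ w, w i * w j ∂P = S i j}

/-- Worst-case CVaR over the moment set, valued in the extended reals. -/
noncomputable def WCVaR {n : ℕ} (ε : ℝ) (S : Matrix (Fin n) (Fin n) ℝ)
    (L : EuclideanSpace ℝ (Fin n) → ℝ) : EReal :=
  ⨆ P ∈ Pset n S, ((CVaR ε P L : ℝ) : EReal)

/-- Quadratic minorant of a function whose Hessian is bounded below by `-σ I`. -/
theorem quadratic_minorant_of_hessian_ge {E : Type*} [NormedAddCommGroup E]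
    [InnerProductSpace ℝ E] [CompleteSpace E] {h : E → ℝ} (hh : ContDiff ℝ 2 h) {σ : ℝ}
    (hHess : ∀ c z : E, -σ * ‖z‖ ^ 2 ≤ iteratedFDeriv ℝ 2 h c ![z, z]) (c z : E) :
    h c + ⟪gradient h c, z⟫ - σ / 2 * ‖z‖ ^ 2 ≤ h (c + z) := by
  have hline (t : ℝ) : HasDerivAt (fun t : ℝ => c + t • z) z t := by
    simpa using ((hasDerivAt_id t).smul_const z).const_add c
  have hfd : Differentiable ℝ (fderiv ℝ h) :=
    (hh.fderiv_right (m := 1) (by norm_num)).differentiable (by norm_num)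
  have hφ (t : ℝ) : HasDerivAt (fun t : ℝ => h (c + t • z) + σ / 2 * ‖z‖ ^ 2 * t ^ 2)
      (fderiv ℝ h (c + t • z) z + σ * ‖z‖ ^ 2 * t) t := by
    have h1 := ((hh.differentiable (by norm_num)) (c + t • z)).hasFDerivAt.comp_hasDerivAt t
      (hline t)
    have h2 := (hasDerivAt_pow 2 t).const_mul (σ / 2 * ‖z‖ ^ 2)
    refine (h1.add h2).congr_deriv ?_
    simp only [Nat.cast_ofNat, Nat.add_one_sub_one, pow_one]
    ring
  have hφ' (t : ℝ) : HasDerivAt (fun t : ℝ => fderiv ℝ h (c + t • z) z + σ * ‖z‖ ^ 2 * t)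
      (fderiv ℝ (fderiv ℝ h) (c + t • z) z z + σ * ‖z‖ ^ 2) t := by
    have h0 : HasDerivAt (fun t : ℝ => fderiv ℝ h (c + t • z))
        (fderiv ℝ (fderiv ℝ h) (c + t • z) z) t :=
      (hfd (c + t • z)).hasFDerivAt.comp_hasDerivAt t (hline t)
    have h1 : HasDerivAt (fun t : ℝ => fderiv ℝ h (c + t • z) z)
        (fderiv ℝ (fderiv ℝ h) (c + t • z) z z) t := by
      simpa using h0.clm_apply (hasDerivAt_const t z)
    have h2 := (hasDerivAt_id t).const_mul (σ * ‖z‖ ^ 2)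
    refine (h1.add h2).congr_deriv ?_
    simp
  have hmono : Monotone fun t : ℝ => fderiv ℝ h (c + t • z) z + σ * ‖z‖ ^ 2 * t := by
    refine monotone_of_deriv_nonneg (fun t => HasDerivAt.differentiableAt (hφ' t)) fun t => ?_
    refine le_of_le_of_eq ?_ (HasDerivAt.deriv (hφ' t)).symm
    have h1 := hHess (c + t • z) z
    rw [iteratedFDeriv_two_apply] at h1
    simp only [Matrix.cons_val_zero, Matrix.cons_val_one] at h1
    linarith
  obtain ⟨ξ, hξ, hξ'⟩ := exists_hasDerivAt_eq_slope
    (fun t : ℝ => h (c + t • z) + σ / 2 * ‖z‖ ^ 2 * t ^ 2)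
    (fun t : ℝ => fderiv ℝ h (c + t • z) z + σ * ‖z‖ ^ 2 * t) (zero_lt_one (α := ℝ))
    (fun t _ => (hφ t).continuousAt.continuousWithinAt) (fun t _ => hφ t)
  have h0 := hmono hξ.1.le
  have hgrad : ⟪gradient h c, z⟫ = fderiv ℝ h c z := by
    simp [gradient]
  simp only [zero_smul, add_zero, one_smul, mul_zero] at h0 hξ'
  rw [hgrad]
  norm_num at hξ'
  linarith

/-- The objective of the variational formula for `CVaR` is bounded below. -/
theorem bddBelow_range_cvar_objective {Ω : Type*} [MeasurableSpace Ω] {P : Measure Ω}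
    [IsProbabilityMeasure P] {ε : ℝ} (hε : ε ∈ Set.Ioo (0 : ℝ) 1) {L : Ω → ℝ}
    (hL : Measurable L) (hint : ∀ β : ℝ, Integrable (fun w => max (L w - β) 0) P) :
    BddBelow (Set.range fun β : ℝ => β + (1 / ε) * ∫ w, max (L w - β) 0 ∂P) := by
  obtain ⟨hε0, hε1⟩ := hε
  have hS (N : ℕ) : MeasurableSet {w | -(N : ℝ) ≤ L w} := measurableSet_le measurable_const hL
  obtain ⟨N, hN⟩ : ∃ N : ℕ, ε < P.real {w | -(N : ℝ) ≤ L w} := by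
    have hm : Monotone fun N : ℕ => {w | -(N : ℝ) ≤ L w} := fun a b hab w hw =>
      (neg_le_neg (Nat.cast_le.2 hab)).trans (show -(a : ℝ) ≤ L w from hw)
    have hU : ⋃ N : ℕ, {w | -(N : ℝ) ≤ L w} = Set.univ := by
      refine Set.eq_univ_of_forall fun w => Set.mem_iUnion.2 ?_
      obtain ⟨N, hN⟩ := exists_nat_ge (-L w)
      exact ⟨N, neg_le.1 hN⟩
    have ht := tendsto_measure_iUnion_atTop (μ := P) hm
    rw [hU, measure_univ] at ht
    have ht' := (ENNReal.tendsto_toReal ENNReal.one_ne_top).comp ht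
    exact (ht'.eventually (lt_mem_nhds (by simpa using hε1))).exists
  refine ⟨-(N : ℝ), ?_⟩
  rintro _ ⟨β, rfl⟩
  have hI : 0 ≤ ∫ w, max (L w - β) 0 ∂P := integral_nonneg fun w => le_max_right _ _
  rcases le_total (-(N : ℝ)) β with hβ | hβ
  · have : 0 ≤ 1 / ε * ∫ w, max (L w - β) 0 ∂P := by positivity
    dsimp only
    linarith
  · have hle : P.real {w | -(N : ℝ) ≤ L w} * (-(N : ℝ) - β) ≤ ∫ w, max (L w - β) 0 ∂P := by
      rw [← smul_eq_mul, ← integral_indicator_const _ (hS N)]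
      refine integral_mono ((integrable_const _).indicator (hS N)) (hint β) fun w => ?_
      by_cases hw : -(N : ℝ) ≤ L w
      · simp [Set.indicator, hw]
      · simp [Set.indicator, hw]
    have h1 : ε * (-(N : ℝ) - β) ≤ ∫ w, max (L w - β) 0 ∂P :=
      (mul_le_mul_of_nonneg_right hN.le (sub_nonneg.2 hβ)).trans hle
    have h2 : -(N : ℝ) - β ≤ 1 / ε * ∫ w, max (L w - β) 0 ∂P := by
      rw [one_div, ← div_eq_inv_mul, le_div_iff₀ hε0]
      linarith
    dsimp only
    linarith

/-- `CVaR` is monotone and translation equivariant; the smaller loss need not be integrable. -/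
theorem CVaR_le_add_of_le {n : ℕ} {ε : ℝ} (hε : ε ∈ Set.Ioo (0 : ℝ) 1)
    {P : Measure (EuclideanSpace ℝ (Fin n))} [IsProbabilityMeasure P]
    {L₁ L₂ : EuclideanSpace ℝ (Fin n) → ℝ} (hL₁ : Measurable L₁) (hL₂ : Integrable L₂ P)
    {a : ℝ} (hle : ∀ w, L₁ w ≤ a + L₂ w) :
    CVaR ε P L₁ ≤ a + CVaR ε P L₂ := by
  have hint₂ (β : ℝ) : Integrable (fun w => max (L₂ w - β) 0) P :=
    (hL₂.sub (integrable_const β)).pos_part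
  have hmax (β : ℝ) (w) : max (L₁ w - (a + β)) 0 ≤ max (L₂ w - β) 0 :=
    max_le_max_right 0 (by linarith [hle w])
  have hint₁ (β : ℝ) : Integrable (fun w => max (L₁ w - β) 0) P := by
    refine (hint₂ (β - a)).mono' (by fun_prop) (Filter.Eventually.of_forall fun w => ?_)
    rw [Real.norm_of_nonneg (le_max_right _ _)]
    simpa using hmax (β - a) w
  rw [← sub_le_iff_le_add']
  refine le_ciInf fun β => ?_
  have h1 : CVaR ε P L₁ ≤ (a + β) + 1 / ε * ∫ w, max (L₁ w - (a + β)) 0 ∂P :=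
    ciInf_le (bddBelow_range_cvar_objective hε hL₁ hint₁) (a + β)
  have h2 := mul_le_mul_of_nonneg_left (integral_mono (hint₁ (a + β)) (hint₂ β) (hmax β))
    (one_div_pos.2 hε.1).le
  linarith

/-- `WCVaR` is monotone and translation equivariant; the smaller loss need not be integrable. -/
theorem WCVaR_le_add_of_le {n : ℕ} {ε : ℝ} (hε : ε ∈ Set.Ioo (0 : ℝ) 1)
    {S : Matrix (Fin n) (Fin n) ℝ} {L₁ L₂ : EuclideanSpace ℝ (Fin n) → ℝ}
    (hL₁ : Measurable L₁) (hL₂ : ∀ P ∈ Pset n S, Integrable L₂ P)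
    {a : ℝ} (hle : ∀ w, L₁ w ≤ a + L₂ w) :
    WCVaR ε S L₁ ≤ (a : EReal) + WCVaR ε S L₂ := by
  refine iSup₂_le fun P hP => ?_
  have := hP.1
  calc ((CVaR ε P L₁ : ℝ) : EReal) ≤ ((a + CVaR ε P L₂ : ℝ) : EReal) :=
        EReal.coe_le_coe_iff.2 (CVaR_le_add_of_le hε hL₁ (hL₂ P hP) hle)
    _ = (a : EReal) + ((CVaR ε P L₂ : ℝ) : EReal) := EReal.coe_add _ _
    _ ≤ (a : EReal) + WCVaR ε S L₂ := by
        gcongr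
        exact le_iSup₂ (f := fun P (_ : P ∈ Pset n S) => ((CVaR ε P L₂ : ℝ) : EReal)) P hP

theorem integrable_quadratic_of_mem_Pset {n : ℕ} {S : Matrix (Fin n) (Fin n) ℝ}
    {P : Measure (EuclideanSpace ℝ (Fin n))} (hP : P ∈ Pset n S)
    (v b : EuclideanSpace ℝ (Fin n)) (k : ℝ) :
    Integrable (fun w => -⟪v, w - b⟫ + k * ‖w - b‖ ^ 2) P := by
  have := hP.1
  have hid : MemLp (fun w : EuclideanSpace ℝ (Fin n) => w) 2 P :=
    (memLp_two_iff_integrable_sq_norm (by fun_prop)).2 hP.2.1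
  have hsub : MemLp (fun w => w - b) 2 P := hid.sub (memLp_const b)
  exact ((hsub.integrable (by norm_num)).const_inner v).neg.add
    ((hsub.integrable_norm_pow (by norm_num)).const_mul k)

/-- (Corollary 2, sufficient condition for the general safe set) If the tractable
upper bound from Lemma 4 is at most −αh(x), then the risk-aware CBF constraint holds. -/
theorem general_safe_set_sufficient {n m : ℕ} (ε : ℝ) (hε : ε ∈ Set.Ioo (0 : ℝ) 1)
    (α : ℝ) (hα : α ∈ Set.Icc (0 : ℝ) 1)
    (f : EuclideanSpace ℝ (Fin n) → EuclideanSpace ℝ (Fin n))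
    (g : EuclideanSpace ℝ (Fin n) → Matrix (Fin n) (Fin m) ℝ)
    (Sw : Matrix (Fin n) (Fin n) ℝ) (hSw : Sw.PosDef)
    (h : EuclideanSpace ℝ (Fin n) → ℝ) (hh : ContDiff ℝ 2 h)
    (σ : ℝ) (hσ : 0 ≤ σ)
    (hHess : ∀ c z : EuclideanSpace ℝ (Fin n),
      -σ * ‖z‖ ^ 2 ≤ iteratedFDeriv ℝ 2 h c ![z, z])
    (x : EuclideanSpace ℝ (Fin n)) (u : Fin m → ℝ)
    (wbar : EuclideanSpace ℝ (Fin n))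
    (hwbar : ∀ i, WCVaR ε Sw (fun w => w i) = ((wbar i : ℝ) : EReal))
    (hsuff :
      ((-h (f x + (EuclideanSpace.equiv (Fin n) ℝ).symm ((g x).mulVec u) + wbar) : ℝ) : EReal) +
          WCVaR ε Sw (fun w =>
            -⟪gradient h (f x + (EuclideanSpace.equiv (Fin n) ℝ).symm ((g x).mulVec u) + wbar),
                w - wbar⟫ + σ / 2 * ‖w - wbar‖ ^ 2) ≤
        ((-(α * h x) : ℝ) : EReal)) :
    WCVaR ε Sw
        (fun w => -h (f x + (EuclideanSpace.equiv (Fin n) ℝ).symm ((g x).mulVec u) + w)) ≤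
      ((-(α * h x) : ℝ) : EReal) := by
  refine (WCVaR_le_add_of_le hε (hh.continuous.comp (by fun_prop)).neg.measurable
    (fun P hP => integrable_quadratic_of_mem_Pset hP _ wbar (σ / 2)) fun w => ?_).trans hsuff
  have key := quadratic_minorant_of_hessian_ge hh hHess
    (f x + (EuclideanSpace.equiv (Fin n) ℝ).symm ((g x).mulVec u) + wbar) (w - wbar)
  rw [add_assoc _ wbar, add_sub_cancel wbar w] at key
  simp only [Pi.neg_apply, Function.comp_apply]
  linarith
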